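/- Let w be a weight function on the goods [m], let n ≥ 1, and let μ = max over n-partitions (Q_1,...,Q_n) of [m] of min_j w(Q_j) be the maximin share. Then there exists an n-partition A = (A_1,...,A_n) of [m] with w(A_1) ≥ w(A_2) ≥ ... ≥ w(A_n) and w(A_i) ≥ μ/2 for every i, such that for every sequence of real valuation parameters v_1 ≥ v_2 ≥ ... ≥ v_n ≥ 0, every n-partition O = (O_1,...,O_n) of [m] satisfying w(O_j) ≥ μ for all j, and every bijection σ of {1,...,n}, one has Σ_{i=1}^n v_i · w(A_i) ≥ Σ_{i=1}^n v_i · w(O_{σ(i)}). That is, a single partition, chosen independently of the valuation parameters, is (1/2)-approximately MMS and its sorted allocation has social welfare at least that of every MMS-feasible allocation. -/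

import Mathlib

open Finset

/-- Weight of a bundle: sum of the weights of its goods. -/
noncomputable def setW {m : ℕ} (w : Fin m → ℝ) (S : Finset (Fin m)) : ℝ := ∑ g ∈ S, w g

/-- An `n`-partition of the goods `[m]`: pairwise disjoint parts covering everything. -/
def IsPartition {m n : ℕ} (P : Fin n → Finset (Fin m)) : Prop :=
  (∀ i j, i ≠ j → Disjoint (P i) (P j)) ∧ Finset.univ.biUnion P = Finset.univ

/-- `μ` is the maximin share: the maximum, over `n`-partitions, of the minimum weight
of a part.  Equivalently, some partition has every part of weight at least `μ`, and every
partition has a part of weight at most `μ`. -/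
def IsMaximinShare {m n : ℕ} (w : Fin m → ℝ) (μ : ℝ) : Prop :=
  (∃ P : Fin n → Finset (Fin m), IsPartition P ∧ ∀ j, μ ≤ setW w (P j)) ∧
  (∀ P : Fin n → Finset (Fin m), IsPartition P → ∃ j, setW w (P j) ≤ μ)

lemma setW_mono {m : ℕ} {w : Fin m → ℝ} (hw : ∀ g, 0 ≤ w g) {S T : Finset (Fin m)}
    (h : S ⊆ T) : setW w S ≤ setW w T :=
  Finset.sum_le_sum_of_subset_of_nonneg h fun g _ _ => hw g

lemma setW_singleton {m : ℕ} (w : Fin m → ℝ) (g : Fin m) : setW w {g} = w g :=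
  Finset.sum_singleton _ _

lemma IsPartition.sum_setW {m n : ℕ} {w : Fin m → ℝ} {P : Fin n → Finset (Fin m)}
    (hP : IsPartition P) : ∑ i, setW w (P i) = setW w Finset.univ := by
  unfold setW
  rw [← hP.2, Finset.sum_biUnion fun i _ j _ hij => hP.1 i j hij]

/-- A bundle of weight at least `c / 2` which is a single good or lighter than `c`. -/
def IsBag {m : ℕ} (w : Fin m → ℝ) (c : ℝ) (B : Finset (Fin m)) : Prop :=
  c / 2 ≤ setW w B ∧ (setW w B < c ∨ ∃ g, B = {g})

lemma exists_isBag_subset {m : ℕ} {w : Fin m → ℝ} {c : ℝ} (hc : 0 < c)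
    {S : Finset (Fin m)} (hS : c / 2 ≤ setW w S) : ∃ B ⊆ S, IsBag w c B := by
  obtain ⟨B, hBS, hB⟩ :=
    exists_minimal_le_of_wellFoundedLT (fun B : Finset (Fin m) => c / 2 ≤ setW w B) S hS
  refine ⟨B, hBS, hB.prop, ?_⟩
  by_cases hbig : ∃ g ∈ B, c / 2 ≤ w g
  · obtain ⟨g, hg, hgc⟩ := hbig
    have hgB : ({g} : Finset (Fin m)) ≤ B := Finset.singleton_subset_iff.2 hg
    exact Or.inr ⟨g, le_antisymm (hB.le_of_le (by rwa [setW_singleton]) hgB) hgB⟩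
  · push Not at hbig
    left
    obtain ⟨g, hg⟩ : B.Nonempty := by
      rw [Finset.nonempty_iff_ne_empty]
      rintro rfl
      have := hB.prop
      simp only [setW, Finset.sum_empty] at this
      linarith
    have hlt : setW w (B.erase g) < c / 2 := by
      by_contra! h
      exact Finset.notMem_erase g B (hB.le_of_le h (Finset.erase_subset g B) hg)
    have hsum : setW w (B.erase g) + w g = setW w B := Finset.sum_erase_add _ _ hg
    linarith [hbig g hg]

/-- A maximal family of disjoint bags leaves goods of total weight less than `c / 2`. -/
lemma exists_bag_family {m : ℕ} (w : Fin m → ℝ) {c : ℝ} (hc : 0 < c) :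
    ∃ F : Finset (Finset (Fin m)), (∀ B ∈ F, IsBag w c B) ∧
      (F : Set (Finset (Fin m))).PairwiseDisjoint id ∧
      setW w (Finset.univ \ F.biUnion id) < c / 2 := by
  obtain ⟨F, -, hF⟩ := exists_maximal_ge_of_wellFoundedGT
    (fun F : Finset (Finset (Fin m)) => (∀ B ∈ F, IsBag w c B) ∧
      (F : Set (Finset (Fin m))).PairwiseDisjoint id) ∅ (by simp)
  refine ⟨F, hF.prop.1, hF.prop.2, ?_⟩
  by_contra! h
  obtain ⟨B, hBsub, hB⟩ := exists_isBag_subset hc h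
  have hdisj : ∀ C ∈ F, Disjoint B C := fun C hC =>
    (Finset.sdiff_disjoint.mono_right (Finset.subset_biUnion_of_mem id hC)).mono_left hBsub
  have hmem : B ∈ F := by
    refine hF.le_of_ge ⟨?_, ?_⟩ (Finset.subset_insert B F) (Finset.mem_insert_self B F)
    · intro C hC
      rcases Finset.mem_insert.1 hC with rfl | hC
      exacts [hB, hF.prop.1 C hC]
    · rw [Finset.coe_insert]
      exact hF.prop.2.insert fun C hC _ => hdisj C hC
  have hempty : B = ∅ := disjoint_self.1 (hdisj B hmem)
  have hB2 := hB.1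
  simp only [hempty, setW, Finset.sum_empty] at hB2
  linarith

/-- The parts of a partition into bundles of weight at least `c` dominate distinct bags. -/
lemma exists_injective_bag_le {m n : ℕ} {w : Fin m → ℝ} (hw : ∀ g, 0 ≤ w g) {c : ℝ}
    (hc : 0 < c) {F : Finset (Finset (Fin m))} (hF : ∀ B ∈ F, IsBag w c B)
    (hdisj : (F : Set (Finset (Fin m))).PairwiseDisjoint id)
    (hrest : setW w (Finset.univ \ F.biUnion id) < c / 2)
    {O : Fin n → Finset (Fin m)} (hO : IsPartition O) (hOc : ∀ j, c ≤ setW w (O j)) :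
    ∃ f : Fin n → Finset (Fin m), Function.Injective f ∧ (∀ j, f j ∈ F) ∧
      ∀ j, setW w (f j) ≤ setW w (O j) := by
  classical
  have hheavy : ∀ g, c ≤ w g → {g} ∈ F := by
    intro g hg
    have hgF : g ∈ F.biUnion id := by
      by_contra hgF
      have : setW w {g} ≤ setW w (Finset.univ \ F.biUnion id) :=
        setW_mono hw (by simpa using hgF)
      rw [setW_singleton] at this
      linarith
    obtain ⟨B, hBF, hgB⟩ := Finset.mem_biUnion.1 hgF
    have hle : setW w {g} ≤ setW w B := setW_mono hw (Finset.singleton_subset_iff.2 hgB)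
    rw [setW_singleton] at hle
    rcases (hF B hBF).2 with h | ⟨g', rfl⟩
    · linarith
    · rwa [Finset.mem_singleton.1 hgB]
  set L := F.filter fun B => setW w B < c
  set K := Finset.univ.filter fun j => ¬ ∃ g ∈ O j, c ≤ w g with hK
  have hcard : K.card ≤ L.card := by
    have h1 : (K.card : ℝ) * c ≤ ∑ j ∈ K, setW w (O j) := by
      rw [← nsmul_eq_mul]
      exact Finset.card_nsmul_le_sum _ _ _ fun j _ => hOc j
    have h2 : ∑ j ∈ K, setW w (O j) = setW w (K.biUnion O) :=
      (Finset.sum_biUnion fun i _ j _ hij => hO.1 i j hij).symm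
    have h3 : setW w (K.biUnion O) ≤
        setW w (L.biUnion id ∪ (Finset.univ \ F.biUnion id)) := by
      refine setW_mono hw fun g hg => ?_
      obtain ⟨j, hj, hgj⟩ := Finset.mem_biUnion.1 hg
      have hgc : w g < c := by
        by_contra! h
        exact (Finset.mem_filter.1 hj).2 ⟨g, hgj, h⟩
      by_cases hgF : g ∈ F.biUnion id
      · obtain ⟨B, hBF, hgB⟩ := Finset.mem_biUnion.1 hgF
        refine Finset.mem_union_left _ (Finset.mem_biUnion.2
          ⟨B, Finset.mem_filter.2 ⟨hBF, ?_⟩, hgB⟩)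
        rcases (hF B hBF).2 with h | ⟨g', rfl⟩
        · exact h
        · rwa [setW_singleton, ← Finset.mem_singleton.1 hgB]
      · exact Finset.mem_union_right _ (by simpa using hgF)
    have h4 : setW w (L.biUnion id ∪ (Finset.univ \ F.biUnion id)) ≤
        setW w (L.biUnion id) + setW w (Finset.univ \ F.biUnion id) := by
      unfold setW
      rw [← Finset.sum_union_inter]
      exact le_add_of_nonneg_right (Finset.sum_nonneg fun g _ => hw g)
    have h5 : setW w (L.biUnion id) = ∑ B ∈ L, setW w B :=
      Finset.sum_biUnion (hdisj.subset (Finset.coe_subset.2 (Finset.filter_subset _ _)))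
    have h6 : ∑ B ∈ L, setW w B ≤ (L.card : ℝ) * c := by
      rw [← nsmul_eq_mul]
      exact Finset.sum_le_card_nsmul _ _ _ fun B hB => (Finset.mem_filter.1 hB).2.le
    have h7 : (K.card : ℝ) * c < (L.card + 1 : ℝ) * c := by nlinarith
    have h8 : (K.card : ℝ) < L.card + 1 := lt_of_mul_lt_mul_right h7 hc.le
    exact Nat.lt_succ_iff.1 (by exact_mod_cast h8)
  obtain ⟨e⟩ : Nonempty (K ↪ L) := Function.Embedding.nonempty_of_card_le (by simpa using hcard)
  have hnot : ∀ j, (¬ ∃ g ∈ O j, c ≤ w g) → j ∈ K := fun j hj => by simpa [hK] using hj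
  have heL : ∀ x : K, (e x : Finset (Fin m)) ∈ F ∧ setW w (e x) < c := fun x =>
    Finset.mem_filter.1 (e x).2
  let f : Fin n → Finset (Fin m) := fun j =>
    if h : ∃ g ∈ O j, c ≤ w g then {h.choose} else e ⟨j, hnot j h⟩
  have hpos : ∀ j, (∃ g ∈ O j, c ≤ w g) → ∃ g ∈ O j, c ≤ w g ∧ f j = {g} := fun j h =>
    ⟨h.choose, h.choose_spec.1, h.choose_spec.2, by simp only [f]; rw [dif_pos h]⟩
  have hneg : ∀ j (h : ¬ ∃ g ∈ O j, c ≤ w g), f j = e ⟨j, hnot j h⟩ := fun j h => by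
    simp only [f]; rw [dif_neg h]
  refine ⟨f, ?_, ?_, ?_⟩
  · intro i j hij
    by_cases hi : ∃ g ∈ O i, c ≤ w g <;> by_cases hj : ∃ g ∈ O j, c ≤ w g
    · obtain ⟨g, hg, -, hfg⟩ := hpos i hi
      obtain ⟨g', hg', -, hfg'⟩ := hpos j hj
      have : g = g' := Finset.singleton_injective (by rw [← hfg, hij, hfg'])
      subst this
      by_contra hne
      exact Finset.disjoint_left.1 (hO.1 i j hne) hg hg'
    · obtain ⟨g, -, hgc, hfg⟩ := hpos i hi
      have := (heL ⟨j, hnot j hj⟩).2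
      rw [← hneg j hj, ← hij, hfg, setW_singleton] at this
      linarith
    · obtain ⟨g, -, hgc, hfg⟩ := hpos j hj
      have := (heL ⟨i, hnot i hi⟩).2
      rw [← hneg i hi, hij, hfg, setW_singleton] at this
      linarith
    · rw [hneg i hi, hneg j hj] at hij
      exact congrArg Subtype.val (e.injective (Subtype.ext hij))
  · intro j
    by_cases hj : ∃ g ∈ O j, c ≤ w g
    · obtain ⟨g, -, hgc, hfg⟩ := hpos j hj
      exact hfg ▸ hheavy g hgc
    · exact hneg j hj ▸ (heL _).1
  · intro j
    by_cases hj : ∃ g ∈ O j, c ≤ w g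
    · obtain ⟨g, hg, -, hfg⟩ := hpos j hj
      exact hfg ▸ setW_mono hw (Finset.singleton_subset_iff.2 hg)
    · rw [hneg j hj]
      exact (heL _).2.le.trans (hOc j)

lemma exists_subset_card_eq_forall_le {α : Type*} (F : Finset α) (φ : α → ℝ) {n : ℕ}
    (hn : n ≤ F.card) :
    ∃ t ⊆ F, t.card = n ∧ ∀ x ∈ t, ∀ y ∈ F, y ∉ t → φ x ≤ φ y := by
  classical
  induction n with
  | zero => exact ⟨∅, by simp⟩
  | succ n ih =>
    obtain ⟨t, htF, htn, ht⟩ := ih (Nat.le_of_succ_le hn)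
    have hne : (F \ t).Nonempty := by
      rw [← Finset.card_pos, Finset.card_sdiff_of_subset htF]
      omega
    obtain ⟨a, ha, hmin⟩ := Finset.exists_min_image (F \ t) φ hne
    obtain ⟨haF, hat⟩ := Finset.mem_sdiff.1 ha
    refine ⟨insert a t, Finset.insert_subset haF htF, ?_, ?_⟩
    · rw [Finset.card_insert_of_notMem hat, htn]
    · intro x hx y hy hyt
      rw [Finset.mem_insert, not_or] at hyt
      rcases Finset.mem_insert.1 hx with rfl | hx
      · exact hmin y (Finset.mem_sdiff.2 ⟨hy, hyt.2⟩)
      · exact ht x hx y hy hyt.2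

/-- There are `n` disjoint bundles of weight at least `c / 2` which, suitably matched, are
dominated by the parts of every partition into bundles of weight at least `c`. -/
lemma exists_dominated_bundles {m n : ℕ} {w : Fin m → ℝ} (hw : ∀ g, 0 ≤ w g) {c : ℝ}
    (hex : ∃ P : Fin n → Finset (Fin m), IsPartition P ∧ ∀ j, c ≤ setW w (P j)) :
    ∃ b : Fin n → Finset (Fin m), (∀ i j, i ≠ j → Disjoint (b i) (b j)) ∧
      Antitone (fun i => setW w (b i)) ∧ (∀ i, c / 2 ≤ setW w (b i)) ∧
      ∀ O : Fin n → Finset (Fin m), IsPartition O → (∀ j, c ≤ setW w (O j)) →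
        ∃ τ : Equiv.Perm (Fin n), ∀ i, setW w (b (τ i)) ≤ setW w (O i) := by
  classical
  rcases le_or_gt c 0 with hc | hc
  · refine ⟨fun _ => ∅, by simp, antitone_const, fun _ => ?_, fun O _ _ => ⟨1, fun i => ?_⟩⟩
    · simp only [setW, Finset.sum_empty]
      linarith
    · exact setW_mono hw (Finset.empty_subset _)
  obtain ⟨F, hF, hdisj, hrest⟩ := exists_bag_family w hc
  have hn : n ≤ F.card := by
    obtain ⟨P, hP, hPc⟩ := hex
    obtain ⟨f, hf, hfF, -⟩ := exists_injective_bag_le hw hc hF hdisj hrest hP hPc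
    simpa using Finset.card_le_card_of_injOn f (s := Finset.univ) (fun j _ => hfF j) hf.injOn
  obtain ⟨t, htF, htn, ht⟩ := exists_subset_card_eq_forall_le F (setW w) hn
  let e₀ : Fin n ≃ t := (Finset.equivFinOfCardEq htn).symm
  let e : Fin n ≃ t := (Tuple.sort fun i => -setW w (e₀ i)).trans e₀
  have hanti : Antitone fun i => setW w (e i) := fun i j hij =>
    neg_le_neg_iff.1 (Tuple.monotone_sort (fun i => -setW w (e₀ i)) hij)
  refine ⟨fun i => e i, fun i j hij => ?_, hanti, fun i => (hF _ (htF (e i).2)).1, ?_⟩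
  · exact hdisj (htF (e i).2) (htF (e j).2) fun h => hij (e.injective (Subtype.ext h))
  · intro O hO hOc
    obtain ⟨f, hf, hfF, hfO⟩ := exists_injective_bag_le hw hc hF hdisj hrest hO hOc
    obtain ⟨g, hg⟩ := Finset.exists_equiv_extend_of_card_eq (t := t)
      (s := Finset.univ.filter fun i => f i ∈ t) (f := f) (by simpa using htn.symm)
      (fun B hB => by
        obtain ⟨i, hi, rfl⟩ := Finset.mem_image.1 hB
        exact (Finset.mem_filter.1 hi).2) hf.injOn
    refine ⟨g.trans e.symm, fun i => le_trans ?_ (hfO i)⟩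
    simp only [Equiv.trans_apply, Equiv.apply_symm_apply]
    by_cases hi : f i ∈ t
    · rw [hg i (by simpa using hi)]
    · exact ht _ (g i).2 _ (hfF i) hi

/-- there is a single partition `A`, sorted by weight and `1/2`-approximately
MMS, whose sorted allocation has social welfare at least that of every MMS-feasible
allocation, for every nonincreasing nonnegative valuation profile. -/
theorem stmt4 {m n : ℕ} (hn : 1 ≤ n) (w : Fin m → ℝ) (hw : ∀ g, 0 ≤ w g)
    (μ : ℝ) (hμ : IsMaximinShare (n := n) w μ) :
    ∃ A : Fin n → Finset (Fin m), IsPartition A ∧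
      Antitone (fun i => setW w (A i)) ∧
      (∀ i, setW w (A i) ≥ μ / 2) ∧
      ∀ v : Fin n → ℝ, Antitone v → (∀ i, 0 ≤ v i) →
        ∀ O : Fin n → Finset (Fin m), IsPartition O → (∀ j, setW w (O j) ≥ μ) →
          ∀ σ : Equiv.Perm (Fin n),
            ∑ i, v i * setW w (A i) ≥ ∑ i, v i * setW w (O (σ i)) := by
  obtain ⟨b, hdisj, hanti, hhalf, hdom⟩ := exists_dominated_bundles hw hμ.1
  let z : Fin n := ⟨0, hn⟩
  have hz : ∀ i, z ≤ i := fun i => Nat.zero_le i.1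
  let R : Finset (Fin m) := Finset.univ \ (Finset.univ.erase z).biUnion b
  let A : Fin n → Finset (Fin m) := fun i => if i = z then R else b i
  have hAz : A z = R := if_pos rfl
  have hA : ∀ i, i ≠ z → A i = b i := fun i hi => if_neg hi
  have hR : ∀ i, i ≠ z → Disjoint R (b i) := fun i hi =>
    Finset.sdiff_disjoint.mono_right
      (Finset.subset_biUnion_of_mem b (Finset.mem_erase.2 ⟨hi, Finset.mem_univ i⟩))
  have hbR : b z ⊆ R := by
    intro g hg
    simp only [R, Finset.mem_sdiff, Finset.mem_univ, true_and, Finset.mem_biUnion, not_exists,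
      not_and]
    intro i hi hgi
    exact Finset.disjoint_left.1 (hdisj i z (Finset.ne_of_mem_erase hi)) hgi hg
  have hbA : ∀ i, setW w (b i) ≤ setW w (A i) := by
    intro i
    by_cases hi : i = z
    · rw [hi, hAz]
      exact setW_mono hw hbR
    · rw [hA i hi]
  have hpart : IsPartition A := by
    refine ⟨fun i j hij => ?_, Finset.eq_univ_of_forall fun g => ?_⟩
    · by_cases hi : i = z
      · have hj : j ≠ z := fun hj => hij (hi.trans hj.symm)
        rw [hi, hAz, hA j hj]
        exact hR j hj
      · rw [hA i hi]
        by_cases hj : j = z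
        · rw [hj, hAz]
          exact (hR i hi).symm
        · rw [hA j hj]
          exact hdisj i j hij
    · by_cases hg : g ∈ R
      · exact Finset.mem_biUnion.2 ⟨z, Finset.mem_univ z, hAz.symm ▸ hg⟩
      · simp only [R, Finset.mem_sdiff, Finset.mem_univ, true_and, not_not] at hg
        obtain ⟨i, hi, hgi⟩ := Finset.mem_biUnion.1 hg
        exact Finset.mem_biUnion.2
          ⟨i, Finset.mem_univ i, (hA i (Finset.ne_of_mem_erase hi)).symm ▸ hgi⟩
  refine ⟨A, hpart, ?_, fun i => (hhalf i).trans (hbA i), ?_⟩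
  · intro i j hij
    by_cases hj : j = z
    · have hi : i = z := le_antisymm (hj ▸ hij) (hz i)
      rw [hi, hj]
    · simp only [hA j hj]
      exact (hanti hij).trans (hbA i)
  · intro v hv _ O hO hOμ σ
    obtain ⟨τ, hτ⟩ := hdom O hO hOμ
    have hu : ∀ i, 0 ≤ v z - v i := fun i => sub_nonneg.2 (hv (hz i))
    have hantivary : Antivary (fun i => v z - v i) fun i => setW w (b i) := by
      have hmono : Monotone fun i => v z - v i := fun i j hij => sub_le_sub_left (hv hij) _
      exact hmono.antivary hanti
    have h1 : ∑ i, (v z - v i) * setW w (A i) = ∑ i, (v z - v i) * setW w (b i) := by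
      refine Finset.sum_congr rfl fun i _ => ?_
      by_cases hi : i = z
      · simp [hi]
      · rw [hA i hi]
    have h2 : ∑ i, (v z - v i) * setW w (b i) ≤
        ∑ i, (v z - v i) * setW w (b ((σ.trans τ) i)) :=
      hantivary.sum_mul_le_sum_mul_comp_perm
    have h3 : ∑ i, (v z - v i) * setW w (b ((σ.trans τ) i)) ≤
        ∑ i, (v z - v i) * setW w (O (σ i)) :=
      Finset.sum_le_sum fun i _ => mul_le_mul_of_nonneg_left (hτ (σ i)) (hu i)
    have h4 : ∑ i, setW w (O (σ i)) = ∑ i, setW w (A i) := by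
      rw [Equiv.sum_comp σ fun i => setW w (O i), hO.sum_setW, hpart.sum_setW]
    have h5 := h1.trans_le (h2.trans h3)
    simp only [sub_mul, Finset.sum_sub_distrib, ← Finset.mul_sum, h4] at h5
    linarith
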